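/- Fix n ∈ ℕ. Let M be a model of IΔ0. If M admits a proper Σ_{n+2}-elementary end extension K which is a model of BΣ_{n+1}, then M satisfies the weak regularity principle WRφ for every formula φ(x,y) in Π_{n+1} with parameters from M: if a ∈ M and M ⊨ ∀x ∃y<a φ(x,y), then M ⊨ ∃y<a ∀b ∃x>b φ(x,y). -/

import Mathlib

namespace PaperArith

/-! ## Syntax of (two-sorted) first-order arithmetic

Terms and formulas of arithmetic in the language `{0, 1, +, ·, <}`,
with number variables and (monadic second-order) set variables both indexed
by natural numbers.  Bounded quantifiers are taken as primitives, so that the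
class `Δ₀` of bounded formulas is a purely syntactic class. -/

/-- Terms of first-order arithmetic in the language `{0, 1, +, ·, <}`. -/
inductive Term : Type
  | var : ℕ → Term
  | zero : Term
  | one : Term
  | add : Term → Term → Term
  | mul : Term → Term → Term

/-- Formulas of (two-sorted) arithmetic.  `mem t i` is the atomic formula
`t ∈ Xᵢ`; `ball x t φ` is `∀ x < t, φ` and `bex x t φ` is `∃ x < t, φ`;
`sall i φ` and `sex i φ` quantify over the set variable `Xᵢ`.
Purely first-order formulas are those avoiding `mem`, `sall`, `sex`. -/
inductive Fml : Type
  | eq : Term → Term → Fml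
  | lt : Term → Term → Fml
  | mem : Term → ℕ → Fml
  | not : Fml → Fml
  | and : Fml → Fml → Fml
  | or : Fml → Fml → Fml
  | imp : Fml → Fml → Fml
  | all : ℕ → Fml → Fml
  | ex : ℕ → Fml → Fml
  | ball : ℕ → Term → Fml → Fml
  | bex : ℕ → Term → Fml → Fml
  | sall : ℕ → Fml → Fml
  | sex : ℕ → Fml → Fml

/-- A structure for the first-order language of arithmetic. -/
structure Str : Type 1 where
  M : Type
  zero : M
  one : M
  add : M → M → M
  mul : M → M → M
  lt : M → M → Prop

/-- Value of a term under a valuation of the number variables. -/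
def tval (S : Str) (v : ℕ → S.M) : Term → S.M
  | .var i => v i
  | .zero => S.zero
  | .one => S.one
  | .add t u => S.add (tval S v t) (tval S v u)
  | .mul t u => S.mul (tval S v t) (tval S v u)

/-- Update a valuation at one variable. -/
def upd {α : Type} (v : ℕ → α) (x : ℕ) (a : α) : ℕ → α :=
  fun i => if i = x then a else v i

/-- Tarskian satisfaction over the structure `S`, with second-order universe
`X` (set quantifiers range over `X`); `v` is the valuation of number
variables, `w` the valuation of set variables. -/
def Sat (S : Str) (X : Set (Set S.M)) : (ℕ → S.M) → (ℕ → Set S.M) → Fml → Prop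
  | v, _, .eq t u => tval S v t = tval S v u
  | v, _, .lt t u => S.lt (tval S v t) (tval S v u)
  | v, w, .mem t i => tval S v t ∈ w i
  | v, w, .not φ => ¬ Sat S X v w φ
  | v, w, .and φ ψ => Sat S X v w φ ∧ Sat S X v w ψ
  | v, w, .or φ ψ => Sat S X v w φ ∨ Sat S X v w ψ
  | v, w, .imp φ ψ => Sat S X v w φ → Sat S X v w ψ
  | v, w, .all x φ => ∀ m : S.M, Sat S X (upd v x m) w φ
  | v, w, .ex x φ => ∃ m : S.M, Sat S X (upd v x m) w φ
  | v, w, .ball x t φ => ∀ m : S.M, S.lt m (tval S v t) → Sat S X (upd v x m) w φ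
  | v, w, .bex x t φ => ∃ m : S.M, S.lt m (tval S v t) ∧ Sat S X (upd v x m) w φ
  | v, w, .sall i φ => ∀ A : Set S.M, A ∈ X → Sat S X v (upd w i A) φ
  | v, w, .sex i φ => ∃ A : Set S.M, A ∈ X ∧ Sat S X v (upd w i A) φ

/-- First-order satisfaction (for purely first-order formulas the second-order
data is irrelevant). -/
def Sat0 (S : Str) (v : ℕ → S.M) (φ : Fml) : Prop :=
  Sat S ∅ v (fun _ => ∅) φ

/-! ## The arithmetic hierarchy -/

/-- `Δ₀` formulas: purely first-order, only bounded quantifiers. -/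
inductive Delta0 : Fml → Prop
  | eq (t u : Term) : Delta0 (.eq t u)
  | lt (t u : Term) : Delta0 (.lt t u)
  | not {φ : Fml} : Delta0 φ → Delta0 (.not φ)
  | and {φ ψ : Fml} : Delta0 φ → Delta0 ψ → Delta0 (.and φ ψ)
  | or {φ ψ : Fml} : Delta0 φ → Delta0 ψ → Delta0 (.or φ ψ)
  | imp {φ ψ : Fml} : Delta0 φ → Delta0 ψ → Delta0 (.imp φ ψ)
  | ball (x : ℕ) (t : Term) {φ : Fml} : Delta0 φ → Delta0 (.ball x t φ)
  | bex (x : ℕ) (t : Term) {φ : Fml} : Delta0 φ → Delta0 (.bex x t φ)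

mutual
  /-- `Σₙ` formulas of the first-order arithmetic hierarchy. -/
  inductive IsSigma : ℕ → Fml → Prop
    | delta0 {n : ℕ} {φ : Fml} : Delta0 φ → IsSigma n φ
    | ofPi {n : ℕ} {φ : Fml} : IsPi n φ → IsSigma (n + 1) φ
    | ex (x : ℕ) {n : ℕ} {φ : Fml} : IsSigma (n + 1) φ → IsSigma (n + 1) (.ex x φ)
  /-- `Πₙ` formulas of the first-order arithmetic hierarchy. -/
  inductive IsPi : ℕ → Fml → Prop
    | delta0 {n : ℕ} {φ : Fml} : Delta0 φ → IsPi n φ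
    | ofSigma {n : ℕ} {φ : Fml} : IsSigma n φ → IsPi (n + 1) φ
    | all (x : ℕ) {n : ℕ} {φ : Fml} : IsPi (n + 1) φ → IsPi (n + 1) (.all x φ)
end

/-- `Σ₀(Σₙ)`: the closure of `Σₙ` under Boolean operations and bounded
quantification. -/
inductive Sigma0Sigma (n : ℕ) : Fml → Prop
  | ofSigma {φ : Fml} : IsSigma n φ → Sigma0Sigma n φ
  | not {φ : Fml} : Sigma0Sigma n φ → Sigma0Sigma n (.not φ)
  | and {φ ψ : Fml} : Sigma0Sigma n φ → Sigma0Sigma n ψ → Sigma0Sigma n (.and φ ψ)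
  | or {φ ψ : Fml} : Sigma0Sigma n φ → Sigma0Sigma n ψ → Sigma0Sigma n (.or φ ψ)
  | imp {φ ψ : Fml} : Sigma0Sigma n φ → Sigma0Sigma n ψ → Sigma0Sigma n (.imp φ ψ)
  | ball (x : ℕ) (t : Term) {φ : Fml} : Sigma0Sigma n φ → Sigma0Sigma n (.ball x t φ)
  | bex (x : ℕ) (t : Term) {φ : Fml} : Sigma0Sigma n φ → Sigma0Sigma n (.bex x t φ)

/-- The class `Σₙ ∧ Πₙ` of conjunctions of a `Σₙ` and a `Πₙ` formula. -/
def SigmaAndPi (n : ℕ) (φ : Fml) : Prop :=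
  ∃ ψ χ : Fml, IsSigma n ψ ∧ IsPi n χ ∧ φ = Fml.and ψ χ

/-- The class `Σₙ ∨ Πₙ` of disjunctions of a `Σₙ` and a `Πₙ` formula. -/
def SigmaOrPi (n : ℕ) (φ : Fml) : Prop :=
  ∃ ψ χ : Fml, IsSigma n ψ ∧ IsPi n χ ∧ φ = Fml.or ψ χ

/-- `Δ₀⁰` formulas of second-order arithmetic: only bounded first-order
quantifiers; free set variables (set parameters) are allowed. -/
inductive Delta0SO : Fml → Prop
  | eq (t u : Term) : Delta0SO (.eq t u)
  | lt (t u : Term) : Delta0SO (.lt t u)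
  | mem (t : Term) (i : ℕ) : Delta0SO (.mem t i)
  | not {φ : Fml} : Delta0SO φ → Delta0SO (.not φ)
  | and {φ ψ : Fml} : Delta0SO φ → Delta0SO ψ → Delta0SO (.and φ ψ)
  | or {φ ψ : Fml} : Delta0SO φ → Delta0SO ψ → Delta0SO (.or φ ψ)
  | imp {φ ψ : Fml} : Delta0SO φ → Delta0SO ψ → Delta0SO (.imp φ ψ)
  | ball (x : ℕ) (t : Term) {φ : Fml} : Delta0SO φ → Delta0SO (.ball x t φ)
  | bex (x : ℕ) (t : Term) {φ : Fml} : Delta0SO φ → Delta0SO (.bex x t φ)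

mutual
  /-- `Σₙ⁰` formulas of the second-order arithmetic hierarchy
  (set parameters allowed, no set quantifiers). -/
  inductive SigmaSO : ℕ → Fml → Prop
    | delta0 {n : ℕ} {φ : Fml} : Delta0SO φ → SigmaSO n φ
    | ofPi {n : ℕ} {φ : Fml} : PiSO n φ → SigmaSO (n + 1) φ
    | ex (x : ℕ) {n : ℕ} {φ : Fml} : SigmaSO (n + 1) φ → SigmaSO (n + 1) (.ex x φ)
  /-- `Πₙ⁰` formulas of the second-order arithmetic hierarchy. -/
  inductive PiSO : ℕ → Fml → Prop
    | delta0 {n : ℕ} {φ : Fml} : Delta0SO φ → PiSO n φ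
    | ofSigma {n : ℕ} {φ : Fml} : SigmaSO n φ → PiSO (n + 1) φ
    | all (x : ℕ) {n : ℕ} {φ : Fml} : PiSO (n + 1) φ → PiSO (n + 1) (.all x φ)
end

/-! ## First-order theories -/

/-- `PA⁻`: the theory of non-negative parts of discretely ordered rings. -/
structure PAminus (S : Str) : Prop where
  add_assoc : ∀ a b c, S.add (S.add a b) c = S.add a (S.add b c)
  add_comm : ∀ a b, S.add a b = S.add b a
  mul_assoc : ∀ a b c, S.mul (S.mul a b) c = S.mul a (S.mul b c)
  mul_comm : ∀ a b, S.mul a b = S.mul b a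
  distrib : ∀ a b c, S.mul a (S.add b c) = S.add (S.mul a b) (S.mul a c)
  add_zero : ∀ a, S.add a S.zero = a
  mul_zero : ∀ a, S.mul a S.zero = S.zero
  mul_one : ∀ a, S.mul a S.one = a
  lt_irrefl : ∀ a, ¬ S.lt a a
  lt_trans : ∀ a b c, S.lt a b → S.lt b c → S.lt a c
  lt_total : ∀ a b, S.lt a b ∨ a = b ∨ S.lt b a
  add_lt_add : ∀ a b c, S.lt a b → S.lt (S.add a c) (S.add b c)
  mul_lt_mul : ∀ a b c, S.lt a b → S.lt S.zero c → S.lt (S.mul a c) (S.mul b c)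
  zero_lt_one : S.lt S.zero S.one
  zero_le : ∀ a, a = S.zero ∨ S.lt S.zero a
  discrete : ∀ a b, S.lt a b → S.add a S.one = b ∨ S.lt (S.add a S.one) b
  pred : ∀ a, S.lt S.zero a → ∃ b, S.add b S.one = a
  sub : ∀ a b, S.lt a b → ∃ c, S.add a c = b

/-- The induction scheme for the class `Γ` of formulas
(parameters are allowed via the ambient valuation `v`). -/
def IndFor (S : Str) (Γ : Fml → Prop) : Prop :=
  ∀ φ : Fml, Γ φ → ∀ (v : ℕ → S.M) (x : ℕ),
    Sat0 S (upd v x S.zero) φ →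
    (∀ m, Sat0 S (upd v x m) φ → Sat0 S (upd v x (S.add m S.one)) φ) →
    ∀ m, Sat0 S (upd v x m) φ

/-- The collection scheme for the class `Γ`:
`(∀ x < a ∃ y φ) → (∃ b ∀ x < a ∃ y < b φ)`. -/
def CollFor (S : Str) (Γ : Fml → Prop) : Prop :=
  ∀ φ : Fml, Γ φ → ∀ (v : ℕ → S.M) (x y : ℕ), x ≠ y → ∀ a : S.M,
    (∀ m, S.lt m a → ∃ k, Sat0 S (upd (upd v x m) y k) φ) →
    ∃ b, ∀ m, S.lt m a → ∃ k, S.lt k b ∧ Sat0 S (upd (upd v x m) y k) φ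

/-- `IΔ₀` (over `PA⁻`). -/
def IDelta0 (S : Str) : Prop := PAminus S ∧ IndFor S Delta0

/-- `IΣₙ` (over `PA⁻`; note `Δ₀ ⊆ Σₙ`, so this includes `IΔ₀`). -/
def ISigma (S : Str) (n : ℕ) : Prop := PAminus S ∧ IndFor S (IsSigma n)

/-- `BΣₙ`: the `Σₙ`-collection scheme, including `IΔ₀` (over `PA⁻`). -/
def BSigma (S : Str) (n : ℕ) : Prop := IDelta0 S ∧ CollFor S (IsSigma n)

/-- The weak regularity principle `WRφ` for all `φ` in the class `Γ`:
the universal closure of `(∀ x ∃ y < a φ(x,y)) → (∃ y < a ∀ b ∃ x > b φ(x,y))`.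
Here `x, y` are the two displayed variables and all other free variables of
`φ` are parameters, interpreted by the ambient valuation `v`. -/
def WRFor (S : Str) (Γ : Fml → Prop) : Prop :=
  ∀ φ : Fml, Γ φ → ∀ (v : ℕ → S.M) (x y : ℕ), x ≠ y → ∀ a : S.M,
    (∀ m, ∃ k, S.lt k a ∧ Sat0 S (upd (upd v x m) y k) φ) →
    ∃ k, S.lt k a ∧ ∀ b, ∃ m, S.lt b m ∧ Sat0 S (upd (upd v x m) y k) φ

/-! ## Second-order theories -/

/-- Second-order induction scheme for the class `Γ`, with set parameters
from the second-order universe `X`. -/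
def IndForSO (S : Str) (X : Set (Set S.M)) (Γ : Fml → Prop) : Prop :=
  ∀ φ : Fml, Γ φ → ∀ (v : ℕ → S.M) (w : ℕ → Set S.M), (∀ i, w i ∈ X) → ∀ x : ℕ,
    Sat S X (upd v x S.zero) w φ →
    (∀ m, Sat S X (upd v x m) w φ → Sat S X (upd v x (S.add m S.one)) w φ) →
    ∀ m, Sat S X (upd v x m) w φ

/-- Second-order collection scheme for the class `Γ`. -/
def CollForSO (S : Str) (X : Set (Set S.M)) (Γ : Fml → Prop) : Prop :=
  ∀ φ : Fml, Γ φ → ∀ (v : ℕ → S.M) (w : ℕ → Set S.M), (∀ i, w i ∈ X) →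
    ∀ (x y : ℕ), x ≠ y → ∀ a : S.M,
    (∀ m, S.lt m a → ∃ k, Sat S X (upd (upd v x m) y k) w φ) →
    ∃ b, ∀ m, S.lt m a → ∃ k, S.lt k b ∧ Sat S X (upd (upd v x m) y k) w φ

/-- `Δ₁⁰`-comprehension. -/
def Delta1CA (S : Str) (X : Set (Set S.M)) : Prop :=
  ∀ φ ψ : Fml, SigmaSO 1 φ → PiSO 1 ψ →
    ∀ (v : ℕ → S.M) (w : ℕ → Set S.M), (∀ i, w i ∈ X) → ∀ x : ℕ,
    (∀ m, Sat S X (upd v x m) w φ ↔ Sat S X (upd v x m) w ψ) →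
    ∃ A ∈ X, ∀ m, m ∈ A ↔ Sat S X (upd v x m) w φ

/-- `Σₙ`-comprehension for first-order formulas with parameters from `M`. -/
def SigmaCA (S : Str) (X : Set (Set S.M)) (n : ℕ) : Prop :=
  ∀ φ : Fml, IsSigma n φ → ∀ (v : ℕ → S.M) (x : ℕ),
    ∃ A ∈ X, ∀ m, m ∈ A ↔ Sat0 S (upd v x m) φ

/-- `RCA₀`. -/
def RCA0 (S : Str) (X : Set (Set S.M)) : Prop :=
  PAminus S ∧ IndForSO S X (SigmaSO 1) ∧ Delta1CA S X

/-- `Σ₁⁰`-separation; over `RCA₀` this is equivalent to weak Kőnig's lemma. -/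
def Sigma1Sep (S : Str) (X : Set (Set S.M)) : Prop :=
  ∀ φ ψ : Fml, SigmaSO 1 φ → SigmaSO 1 ψ →
    ∀ (v : ℕ → S.M) (w : ℕ → Set S.M), (∀ i, w i ∈ X) → ∀ x : ℕ,
    (∀ m, ¬ (Sat S X (upd v x m) w φ ∧ Sat S X (upd v x m) w ψ)) →
    ∃ A ∈ X, ∀ m, (Sat S X (upd v x m) w φ → m ∈ A) ∧ (m ∈ A → ¬ Sat S X (upd v x m) w ψ)

/-- `WKL₀`, rendered as `RCA₀` plus `Σ₁⁰`-separation (which is equivalent,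
over `RCA₀`, to weak Kőnig's lemma). -/
def WKL0 (S : Str) (X : Set (Set S.M)) : Prop := RCA0 S X ∧ Sigma1Sep S X

/-- `BΣₙ⁰`: the second-order `Σₙ⁰`-collection scheme (including `IΔ₀⁰`,
over `PA⁻`). -/
def BSigmaSO (S : Str) (X : Set (Set S.M)) (n : ℕ) : Prop :=
  PAminus S ∧ IndForSO S X Delta0SO ∧ CollForSO S X (SigmaSO n)

/-- `IΣₙ⁰`: the second-order `Σₙ⁰`-induction scheme, over `RCA₀`. -/
def ISigmaSO (S : Str) (X : Set (Set S.M)) (n : ℕ) : Prop :=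
  RCA0 S X ∧ IndForSO S X (SigmaSO n)

/-! ## Exponentiation and binary digits -/

/-- Satisfaction of a three-variable formula `E(x₀, x₁, x₂)` at `(a, b, c)`. -/
def ExpAt (S : Str) (E : Fml) (a b c : S.M) : Prop :=
  Sat0 S (fun i => if i = 0 then a else if i = 1 then b else c) E

/-- `E(x₀,x₁,x₂)` is a `Δ₀` definition of the (total) exponentiation function
`x₀ ^ x₁ = x₂`.  The existence of such an `E` expresses `exp`
(the totality of exponentiation). -/
structure IsExpDef (S : Str) (E : Fml) : Prop where
  delta0 : Delta0 E
  base : ∀ a, ExpAt S E a S.zero S.one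
  total : ∀ a b, ∃ c, ExpAt S E a b c
  unique : ∀ a b c c', ExpAt S E a b c → ExpAt S E a b c' → c = c'
  step : ∀ a b c, ExpAt S E a b c → ExpAt S E a (S.add b S.one) (S.mul c a)

/-- `exp`: the totality of exponentiation (via a `Δ₀` definition of its
graph). -/
def SatExp (S : Str) : Prop := ∃ E : Fml, IsExpDef S E

/-! ## Embeddings, end extensions and elementarity -/

/-- An embedding of arithmetic structures. -/
structure Emb (S K : Str) where
  j : S.M → K.M
  inj : Function.Injective j
  zero : j S.zero = K.zero
  one : j S.one = K.one
  add : ∀ a b, j (S.add a b) = K.add (j a) (j b)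
  mul : ∀ a b, j (S.mul a b) = K.mul (j a) (j b)
  lt_iff : ∀ a b, S.lt a b ↔ K.lt (j a) (j b)

/-- The extension along `e` is an end extension: every element of `K` not in
the image of `M` exceeds every element of `M`. -/
def IsEndExt {S K : Str} (e : Emb S K) : Prop :=
  ∀ b : K.M, b ∉ Set.range e.j → ∀ a : S.M, K.lt (e.j a) b

/-- The extension along `e` is proper. -/
def IsProper {S K : Str} (e : Emb S K) : Prop := ¬ Function.Surjective e.j

/-- The extension along `e` is `Σₙ`-elementary: all `Σₙ` formulas with
parameters from `M` are absolute between `M` and `K`. -/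
def SigmaElem {S K : Str} (e : Emb S K) (n : ℕ) : Prop :=
  ∀ φ : Fml, IsSigma n φ → ∀ v : ℕ → S.M,
    (Sat0 S v φ ↔ Sat0 K (fun i => e.j (v i)) φ)

/-- `K ⊨ M‑IΣₙ` (for an extension `e : M → K`): induction up to any `a ∈ M`
for `Σₙ` formulas with parameters from `K`. -/
def MISigma {S K : Str} (e : Emb S K) (n : ℕ) : Prop :=
  ∀ φ : Fml, IsSigma n φ → ∀ (v : ℕ → K.M) (x : ℕ) (a : S.M),
    Sat0 K (upd v x K.zero) φ →
    (∀ m, K.lt m (e.j a) → (Sat0 K (upd v x m) φ → Sat0 K (upd v x (K.add m K.one)) φ)) →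
    ∀ m, K.lt m (e.j a) → Sat0 K (upd v x m) φ

/-- The `x`-th binary digit of `c ∈ K` is `1`, computed via a `Δ₀` definition
`E` of exponentiation on the ground model `S` (here `x` lies under the image
of `S`): there are `x', p ∈ M` with `j x' = x`, `p = 2 ^ x'`, and `u, v ∈ K`
with `c = u·(2p) + p + v` and `v < p`. -/
def BitVia {S K : Str} (e : Emb S K) (E : Fml) (x c : K.M) : Prop :=
  ∃ x' p : S.M, e.j x' = x ∧ ExpAt S E (S.add S.one S.one) x' p ∧
    ∃ u v : K.M, K.lt v (e.j p) ∧
      c = K.add (K.add (K.mul u (K.add (e.j p) (e.j p))) (e.j p)) v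

/-! ## The second-order restricted ultrapower -/

/-- `A` is cofinal (unbounded) in `S`. -/
def Cofinal (S : Str) (A : Set S.M) : Prop := ∀ b : S.M, ∃ x ∈ A, S.lt b x

/-- The pairing term `⟨x, y⟩ = (x + y)·(x + y) + x`. -/
def pairS (S : Str) (x y : S.M) : S.M := S.add (S.mul (S.add x y) (S.add x y)) x

/-- The graph of `f : M → M`, coded as a subset of `M` via pairing. -/
def graphOf (S : Str) (f : S.M → S.M) : Set S.M := {m | ∃ x, m = pairS S x (f x)}

/-- `f` is a total function `M → M` lying in the second-order universe `X`
(its coded graph belongs to `X`).  The collection of such `f` is the class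
`ℱ` of the restricted ultrapower. -/
def FuncIn (S : Str) (X : Set (Set S.M)) (f : S.M → S.M) : Prop := graphOf S f ∈ X

/-- `U` is an ultrafilter on the Boolean algebra `X`, all of whose elements
are cofinal in `M`. -/
structure UltraOn (S : Str) (X U : Set (Set S.M)) : Prop where
  subset : U ⊆ X
  univ_mem : Set.univ ∈ U
  empty_not_mem : ∅ ∉ U
  inter_mem : ∀ A ∈ U, ∀ B ∈ U, A ∩ B ∈ U
  superset_mem : ∀ A ∈ U, ∀ B ∈ X, A ⊆ B → B ∈ U
  ultra : ∀ A ∈ X, A ∈ U ∨ Aᶜ ∈ U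
  cofinal : ∀ A ∈ U, Cofinal S A

/-- A realization of the second-order restricted ultrapower `ℱ/𝒰` of `S`
with respect to the second-order universe `X` and the ultrafilter `U`:
a structure `K` whose elements are exactly the classes `cls f hf = [f]` of
total functions `f ∈ ℱ`, where `[f] = [g]` iff `f = g` on a set in `U`, with
pointwise arithmetic operations, order decided by `U`, and the inherited
second-order membership relation `memK` serving as the second-order expansion. -/
structure RUP (S : Str) (X U : Set (Set S.M)) : Type 1 where
  K : Str
  cls : (f : S.M → S.M) → FuncIn S X f → K.M
  memK : K.M → Set S.M → Prop
  const_in : ∀ a : S.M, FuncIn S X (fun _ => a)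
  surj : ∀ b : K.M, ∃ (f : S.M → S.M) (hf : FuncIn S X f), cls f hf = b
  eq_iff : ∀ (f : S.M → S.M) (hf : FuncIn S X f) (g : S.M → S.M) (hg : FuncIn S X g),
      (cls f hf = cls g hg) ↔ {i : S.M | f i = g i} ∈ U
  lt_iff : ∀ (f : S.M → S.M) (hf : FuncIn S X f) (g : S.M → S.M) (hg : FuncIn S X g),
      K.lt (cls f hf) (cls g hg) ↔ {i : S.M | S.lt (f i) (g i)} ∈ U
  zero_eq : K.zero = cls (fun _ => S.zero) (const_in S.zero)
  one_eq : K.one = cls (fun _ => S.one) (const_in S.one)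
  add_eq : ∀ (f : S.M → S.M) (hf : FuncIn S X f) (g : S.M → S.M) (hg : FuncIn S X g)
      (h : S.M → S.M) (hh : FuncIn S X h), (∀ i, h i = S.add (f i) (g i)) →
      K.add (cls f hf) (cls g hg) = cls h hh
  mul_eq : ∀ (f : S.M → S.M) (hf : FuncIn S X f) (g : S.M → S.M) (hg : FuncIn S X g)
      (h : S.M → S.M) (hh : FuncIn S X h), (∀ i, h i = S.mul (f i) (g i)) →
      K.mul (cls f hf) (cls g hg) = cls h hh
  mem_iff : ∀ (f : S.M → S.M) (hf : FuncIn S X f) (A : Set S.M), A ∈ X →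
      (memK (cls f hf) A ↔ {i : S.M | f i ∈ A} ∈ U)

/-- The canonical embedding `M → ℱ/𝒰` via constant functions. -/
def RUP.emb {S : Str} {X U : Set (Set S.M)} (R : RUP S X U) (a : S.M) : R.K.M :=
  R.cls (fun _ => a) (R.const_in a)

/-- The subset of `ℱ/𝒰` induced by `A ⊆ M`. -/
def RUP.setImg {S : Str} {X U : Set (Set S.M)} (R : RUP S X U) (A : Set S.M) :
    Set R.K.M := {b | R.memK b A}

/-- The second-order part of the expanded ultrapower `(ℱ/𝒰, 𝒳)`:
the (injected) copy of `X`. -/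
def RUP.X2 {S : Str} {X U : Set (Set S.M)} (R : RUP S X U) : Set (Set R.K.M) :=
  (fun A => R.setImg A) '' X

end PaperArith

namespace PaperArith

theorem tval_finite_support (t : Term) : ∃ N : ℕ, ∀ (T : Str) (v v' : ℕ → T.M),
    (∀ i < N, v i = v' i) → tval T v t = tval T v' t := by
  induction t with
  | var i => exact ⟨i + 1, fun T v v' h => h i (Nat.lt_succ_self i)⟩
  | zero => exact ⟨0, fun T v v' _ => rfl⟩
  | one => exact ⟨0, fun T v v' _ => rfl⟩
  | add t u iht ihu =>
    obtain ⟨N, hN⟩ := iht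
    obtain ⟨N', hN'⟩ := ihu
    refine ⟨max N N', fun T v v' h => ?_⟩
    simp only [tval]
    rw [hN T v v' fun i hi => h i (lt_max_of_lt_left hi),
      hN' T v v' fun i hi => h i (lt_max_of_lt_right hi)]
  | mul t u iht ihu =>
    obtain ⟨N, hN⟩ := iht
    obtain ⟨N', hN'⟩ := ihu
    refine ⟨max N N', fun T v v' h => ?_⟩
    simp only [tval]
    rw [hN T v v' fun i hi => h i (lt_max_of_lt_left hi),
      hN' T v v' fun i hi => h i (lt_max_of_lt_right hi)]

theorem upd_agree {α : Type} {N : ℕ} {v v' : ℕ → α} (h : ∀ i < N, v i = v' i) (x : ℕ) (m : α) :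
    ∀ i < N, upd v x m i = upd v' x m i := by
  intro i hi
  simp only [upd, h i hi]

/-- Satisfaction depends on finitely many number variables only. -/
theorem sat_finite_support (φ : Fml) : ∃ N : ℕ, ∀ (T : Str) (X : Set (Set T.M)) (v v' : ℕ → T.M)
    (w : ℕ → Set T.M), (∀ i < N, v i = v' i) → (Sat T X v w φ ↔ Sat T X v' w φ) := by
  induction φ with
  | eq t u | lt t u =>
    obtain ⟨N, hN⟩ := tval_finite_support t
    obtain ⟨N', hN'⟩ := tval_finite_support u
    refine ⟨max N N', fun T X v v' w h => ?_⟩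
    simp only [Sat]
    rw [hN T v v' fun i hi => h i (lt_max_of_lt_left hi),
      hN' T v v' fun i hi => h i (lt_max_of_lt_right hi)]
  | mem t j =>
    obtain ⟨N, hN⟩ := tval_finite_support t
    refine ⟨N, fun T X v v' w h => ?_⟩
    simp only [Sat]
    rw [hN T v v' h]
  | not φ ih =>
    obtain ⟨N, hN⟩ := ih
    exact ⟨N, fun T X v v' w h => not_congr (hN T X v v' w h)⟩
  | and φ ψ ih ih' | or φ ψ ih ih' | imp φ ψ ih ih' =>
    obtain ⟨N, hN⟩ := ih
    obtain ⟨N', hN'⟩ := ih'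
    refine ⟨max N N', fun T X v v' w h => ?_⟩
    simp only [Sat]
    rw [hN T X v v' w fun i hi => h i (lt_max_of_lt_left hi),
      hN' T X v v' w fun i hi => h i (lt_max_of_lt_right hi)]
  | all x φ ih =>
    obtain ⟨N, hN⟩ := ih
    exact ⟨N, fun T X v v' w h => forall_congr' fun m => hN T X _ _ w (upd_agree h x m)⟩
  | ex x φ ih =>
    obtain ⟨N, hN⟩ := ih
    exact ⟨N, fun T X v v' w h => exists_congr fun m => hN T X _ _ w (upd_agree h x m)⟩
  | ball x t φ ih | bex x t φ ih =>
    obtain ⟨N, hN⟩ := ih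
    obtain ⟨N', hN'⟩ := tval_finite_support t
    refine ⟨max N N', fun T X v v' w h => ?_⟩
    have hφ := fun m => hN T X _ _ w (upd_agree (fun i hi => h i (lt_max_of_lt_left hi)) x m)
    have ht := hN' T v v' fun i hi => h i (lt_max_of_lt_right hi)
    simp only [Sat, ht, hφ]
  | sall j φ ih =>
    obtain ⟨N, hN⟩ := ih
    exact ⟨N, fun T X v v' w h => forall_congr' fun A => imp_congr_right fun _ => hN T X _ _ _ h⟩
  | sex j φ ih =>
    obtain ⟨N, hN⟩ := ih
    exact ⟨N, fun T X v v' w h => exists_congr fun A => and_congr_right fun _ => hN T X _ _ _ h⟩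

theorem sat0_finite_support (φ : Fml) : ∃ N : ℕ, ∀ (T : Str) (v v' : ℕ → T.M),
    (∀ i < N, v i = v' i) → (Sat0 T v φ ↔ Sat0 T v' φ) := by
  obtain ⟨N, hN⟩ := sat_finite_support φ
  exact ⟨N, fun T v v' h => hN T _ v v' _ h⟩

section Sat0

variable {T : Str} {v : ℕ → T.M} {φ ψ : Fml} {x : ℕ} {t u : Term}

theorem sat0_lt : Sat0 T v (.lt t u) ↔ T.lt (tval T v t) (tval T v u) := Iff.rfl
theorem sat0_not : Sat0 T v (.not φ) ↔ ¬ Sat0 T v φ := Iff.rfl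
theorem sat0_and : Sat0 T v (.and φ ψ) ↔ Sat0 T v φ ∧ Sat0 T v ψ := Iff.rfl
theorem sat0_or : Sat0 T v (.or φ ψ) ↔ Sat0 T v φ ∨ Sat0 T v ψ := Iff.rfl
theorem sat0_all : Sat0 T v (.all x φ) ↔ ∀ m, Sat0 T (upd v x m) φ := Iff.rfl
theorem sat0_ex : Sat0 T v (.ex x φ) ↔ ∃ m, Sat0 T (upd v x m) φ := Iff.rfl
theorem sat0_ball :
    Sat0 T v (.ball x t φ) ↔ ∀ m, T.lt m (tval T v t) → Sat0 T (upd v x m) φ := Iff.rfl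
theorem sat0_bex :
    Sat0 T v (.bex x t φ) ↔ ∃ m, T.lt m (tval T v t) ∧ Sat0 T (upd v x m) φ := Iff.rfl

end Sat0

mutual
  theorem IsSigma.succ : ∀ {n : ℕ} {φ : Fml}, IsSigma n φ → IsSigma (n + 1) φ
    | _, _, .delta0 h => .delta0 h
    | _, _, .ofPi h => .ofPi h.succ
    | _, _, .ex x h => .ex x h.succ
  theorem IsPi.succ : ∀ {n : ℕ} {φ : Fml}, IsPi n φ → IsPi (n + 1) φ
    | _, _, .delta0 h => .delta0 h
    | _, _, .ofSigma h => .ofSigma h.succ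
    | _, _, .all x h => .all x h.succ
end

theorem IsSigma.mono {m n : ℕ} (hmn : m ≤ n) {φ : Fml} (h : IsSigma m φ) : IsSigma n φ := by
  induction hmn with
  | refl => exact h
  | step _ ih => exact ih.succ

theorem IsSigma.delta0_of_zero {φ : Fml} (h : IsSigma 0 φ) : Delta0 φ := by
  cases h
  assumption

mutual
  theorem IsSigma.exists_neg : ∀ {n : ℕ} {φ : Fml}, IsSigma n φ →
      ∃ ψ, IsPi n ψ ∧ ∀ (T : Str) (v : ℕ → T.M), Sat0 T v ψ ↔ ¬ Sat0 T v φ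
    | _, φ, .delta0 h => ⟨.not φ, .delta0 h.not, fun _ _ => sat0_not⟩
    | _, _, .ofPi h =>
      let ⟨ψ, hψ, e⟩ := h.exists_neg
      ⟨ψ, .ofSigma hψ, e⟩
    | _, _, .ex x h =>
      let ⟨ψ, hψ, e⟩ := h.exists_neg
      ⟨.all x ψ, .all x hψ, fun T v => by simp only [sat0_all, sat0_ex, e, not_exists]⟩
  theorem IsPi.exists_neg : ∀ {n : ℕ} {φ : Fml}, IsPi n φ →
      ∃ ψ, IsSigma n ψ ∧ ∀ (T : Str) (v : ℕ → T.M), Sat0 T v ψ ↔ ¬ Sat0 T v φ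
    | _, φ, .delta0 h => ⟨.not φ, .delta0 h.not, fun _ _ => sat0_not⟩
    | _, _, .ofSigma h =>
      let ⟨ψ, hψ, e⟩ := h.exists_neg
      ⟨ψ, .ofPi hψ, e⟩
    | _, _, .all x h =>
      let ⟨ψ, hψ, e⟩ := h.exists_neg
      ⟨.ex x ψ, .ex x hψ, fun T v => by simp only [sat0_all, sat0_ex, e, not_forall]⟩
end

/-- `φ` and `ψ` are equivalent in all structures of the class `C`. -/
def EquivOn (C : Str → Prop) (φ ψ : Fml) : Prop :=
  ∀ T, C T → ∀ v : ℕ → T.M, Sat0 T v φ ↔ Sat0 T v ψ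

/-- `φ` is equivalent, in all structures of the class `C`, to a formula in `Γ`. -/
def Like (C : Str → Prop) (Γ : Fml → Prop) (φ : Fml) : Prop :=
  ∃ ψ, Γ ψ ∧ EquivOn C φ ψ

/-- Modulo equivalence over `C`, the class `Γ` is closed under bounded quantification and
under conjunction and disjunction with `Δ₀` formulas. -/
structure BddClosed (C : Str → Prop) (Γ : Fml → Prop) : Prop where
  ball {φ : Fml} (x : ℕ) (t : Term) : Like C Γ φ → Like C Γ (.ball x t φ)
  bex {φ : Fml} (x : ℕ) (t : Term) : Like C Γ φ → Like C Γ (.bex x t φ)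
  and {δ φ : Fml} : Delta0 δ → Like C Γ φ → Like C Γ (.and δ φ)
  or {δ φ : Fml} : Delta0 δ → Like C Γ φ → Like C Γ (.or δ φ)

section Like

variable {C : Str → Prop} {Γ : Fml → Prop} {φ ψ : Fml} {k : ℕ}

theorem Like.of_mem (h : Γ φ) : Like C Γ φ := ⟨φ, h, fun _ _ _ => Iff.rfl⟩

theorem Like.of_equiv (h : Like C Γ ψ) (he : EquivOn C φ ψ) : Like C Γ φ := by
  obtain ⟨χ, hχ, e⟩ := h
  exact ⟨χ, hχ, fun T hT v => (he T hT v).trans (e T hT v)⟩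

theorem Like.neg_sigma (h : Like C (IsSigma k) φ) : Like C (IsPi k) (.not φ) := by
  obtain ⟨ψ, hψ, e⟩ := h
  obtain ⟨χ, hχ, e'⟩ := hψ.exists_neg
  exact ⟨χ, hχ, fun T hT v => by rw [e', sat0_not, e T hT v]⟩

theorem Like.neg_pi (h : Like C (IsPi k) φ) : Like C (IsSigma k) (.not φ) := by
  obtain ⟨ψ, hψ, e⟩ := h
  obtain ⟨χ, hχ, e'⟩ := hψ.exists_neg
  exact ⟨χ, hχ, fun T hT v => by rw [e', sat0_not, e T hT v]⟩

theorem Like.ex_pi (x : ℕ) (h : Like C (IsPi k) φ) : Like C (IsSigma (k + 1)) (.ex x φ) := by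
  obtain ⟨ψ, hψ, e⟩ := h
  exact ⟨.ex x ψ, .ex x (.ofPi hψ), fun T hT v => exists_congr fun m => e T hT _⟩

theorem Like.ex_sigma (x : ℕ) (h : Like C (IsSigma (k + 1)) φ) :
    Like C (IsSigma (k + 1)) (.ex x φ) := by
  obtain ⟨ψ, hψ, e⟩ := h
  exact ⟨.ex x ψ, .ex x hψ, fun T hT v => exists_congr fun m => e T hT _⟩

theorem BddClosed.pi_of_sigma (h : BddClosed C (IsSigma k)) : BddClosed C (IsPi k) where
  ball x t hφ := (h.bex x t hφ.neg_pi).neg_sigma.of_equiv fun T hT v => by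
    simp only [sat0_ball, sat0_not, sat0_bex, not_exists, not_and, not_not]
  bex x t hφ := (h.ball x t hφ.neg_pi).neg_sigma.of_equiv fun T hT v => by
    simp only [sat0_ball, sat0_not, sat0_bex, not_forall, not_not, exists_prop]
  and hδ hφ := (h.or hδ.not hφ.neg_pi).neg_sigma.of_equiv fun T hT v => by
    simp only [sat0_and, sat0_not, sat0_or, not_or, not_not]
  or hδ hφ := (h.and hδ.not hφ.neg_pi).neg_sigma.of_equiv fun T hT v => by
    simp only [sat0_and, sat0_not, sat0_or, not_and_or, not_not]

end Like

theorem PAminus.exists_gt_two {T : Str} (h : PAminus T) (a b : T.M) :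
    ∃ c, T.lt a c ∧ T.lt b c := by
  have hlt : ∀ a, T.lt a (T.add a T.one) := fun a => by
    have := h.add_lt_add _ _ a h.zero_lt_one
    rwa [h.add_comm, h.add_zero, h.add_comm] at this
  rcases h.lt_total a b with hab | rfl | hab
  · exact ⟨_, h.lt_trans _ _ _ hab (hlt b), hlt b⟩
  · exact ⟨_, hlt a, hlt a⟩
  · exact ⟨_, hlt a, h.lt_trans _ _ _ hab (hlt a)⟩

section Closure

variable {C : Str → Prop} {k : ℕ}

/-- Contraction of a block of existential quantifiers: a `Σₖ₊₁` formula is equivalent to a single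
existential quantifier, over an arbitrarily late variable, in front of a `Πₖ` formula. -/
theorem IsSigma.exists_normal_form (hC : ∀ T, C T → PAminus T)
    (hk : BddClosed C (IsSigma k)) {φ : Fml} (h : IsSigma (k + 1) φ) (N : ℕ) :
    ∃ c θ, N ≤ c ∧ IsPi k θ ∧ EquivOn C φ (.ex c θ) := by
  have dummy : ∀ {φ : Fml}, IsPi k φ → ∀ N, ∃ c θ, N ≤ c ∧ IsPi k θ ∧ EquivOn C φ (.ex c θ) := by
    intro φ hφ N
    obtain ⟨N', hN'⟩ := sat0_finite_support φ
    refine ⟨max N N', φ, le_max_left _ _, hφ, fun T hT v => ?_⟩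
    have key : ∀ m, Sat0 T v φ ↔ Sat0 T (upd v (max N N') m) φ := fun m => by
      refine hN' T _ _ fun i hi => ?_
      have : i ≠ max N N' := by omega
      simp [upd, this]
    rw [sat0_ex]
    exact ⟨fun h => ⟨T.zero, (key _).1 h⟩, fun ⟨m, h⟩ => (key m).2 h⟩
  generalize hj : k + 1 = j at h
  induction φ generalizing N with
  | ex x φ ih =>
    cases h with
    | delta0 h => exact dummy (.delta0 h) N
    | ofPi h =>
      obtain rfl : k = _ := Nat.succ_injective hj
      exact dummy h N
    | ex _ h =>
      obtain ⟨b, θ, hb, hθ, e⟩ := ih (x + 1) h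
      obtain ⟨N', hN'⟩ := sat0_finite_support θ
      obtain ⟨c, hc⟩ : ∃ c, c = N + N' + x + b + 1 := ⟨_, rfl⟩
      obtain ⟨χ, hχ, e'⟩ := hk.pi_of_sigma.bex x (.var c)
        (hk.pi_of_sigma.bex b (.var c) (.of_mem hθ))
      refine ⟨c, χ, by omega, hχ, fun T hT v => ?_⟩
      have key : ∀ g m l, Sat0 T (upd (upd (upd v c g) x m) b l) θ ↔
          Sat0 T (upd (upd v x m) b l) θ := fun g m l => by
        refine hN' T _ _ fun i hi => ?_
        have : i ≠ c := by omega
        simp [upd, this]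
      have hcx : c ≠ x := by omega
      simp only [sat0_ex, ← e' T hT, e T hT, sat0_bex, key]
      simp only [tval, upd, if_neg hcx, if_true]
      constructor
      · rintro ⟨m, l, h⟩
        obtain ⟨g, hg, hg'⟩ := (hC T hT).exists_gt_two m l
        exact ⟨g, m, hg, l, hg', h⟩
      · rintro ⟨g, m, -, l, -, h⟩
        exact ⟨m, l, h⟩
  | _ =>
    cases h with
    | delta0 h => exact dummy (.delta0 h) N
    | ofPi h =>
      obtain rfl : k = _ := Nat.succ_injective hj
      exact dummy h N

theorem bddClosed_sigma_zero : BddClosed C (IsSigma 0) where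
  ball x t h := by
    obtain ⟨ψ, hψ, e⟩ := h
    exact ⟨.ball x t ψ, .delta0 (.ball x t hψ.delta0_of_zero), fun T hT v =>
      forall_congr' fun m => imp_congr_right fun _ => e T hT _⟩
  bex x t h := by
    obtain ⟨ψ, hψ, e⟩ := h
    exact ⟨.bex x t ψ, .delta0 (.bex x t hψ.delta0_of_zero), fun T hT v =>
      exists_congr fun m => and_congr_right fun _ => e T hT _⟩
  and {δ _} hδ h := by
    obtain ⟨ψ, hψ, e⟩ := h
    exact ⟨.and δ ψ, .delta0 (.and hδ hψ.delta0_of_zero), fun T hT v =>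
      and_congr_right fun _ => e T hT _⟩
  or {δ _} hδ h := by
    obtain ⟨ψ, hψ, e⟩ := h
    exact ⟨.or δ ψ, .delta0 (.or hδ hψ.delta0_of_zero), fun T hT v =>
      or_congr_right (e T hT _)⟩

theorem BddClosed.sigma_succ (hC : ∀ T, C T → PAminus T)
    (hcoll : ∀ T, C T → CollFor T (IsSigma (k + 1)))
    (hk : BddClosed C (IsSigma k)) : BddClosed C (IsSigma (k + 1)) where
  ball {φ} y t h := by
    obtain ⟨φ', hφ', e⟩ := h
    obtain ⟨c, θ, hc, hθ, e'⟩ := hφ'.exists_normal_form hC hk (y + 1)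
    obtain ⟨N, hN⟩ := sat0_finite_support θ
    obtain ⟨N', hN'⟩ := tval_finite_support t
    obtain ⟨d, hd⟩ : ∃ d, d = N + N' + y + c + 1 := ⟨_, rfl⟩
    refine ((hk.pi_of_sigma.ball y t (hk.pi_of_sigma.bex c (.var d) (.of_mem hθ))).ex_pi
      d).of_equiv fun T hT v => ?_
    have key : ∀ g m l, Sat0 T (upd (upd (upd v d g) y m) c l) θ ↔
        Sat0 T (upd (upd v y m) c l) θ := fun g m l => by
      refine hN T _ _ fun i hi => ?_
      have : i ≠ d := by omega
      simp [upd, this]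
    have ht : ∀ g, tval T (upd v d g) t = tval T v t := fun g => by
      refine hN' T _ _ fun i hi => ?_
      have : i ≠ d := by omega
      simp [upd, this]
    have hdy : d ≠ y := by omega
    simp only [sat0_ex, e T hT, e' T hT, sat0_bex, sat0_ball, key, ht]
    simp only [tval, upd, if_neg hdy, if_true]
    constructor
    · exact hcoll T hT θ (.ofPi hθ) v y c (by omega) _
    · rintro ⟨g, h⟩ m hm
      obtain ⟨l, -, hl⟩ := h m hm
      exact ⟨l, hl⟩
  bex {φ} y t h := by
    obtain ⟨φ', hφ', e⟩ := h
    obtain ⟨c, θ, hc, hθ, e'⟩ := hφ'.exists_normal_form hC hk (y + 1)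
    obtain ⟨N, hN⟩ := sat0_finite_support θ
    obtain ⟨N', hN'⟩ := tval_finite_support t
    obtain ⟨d, hd⟩ : ∃ d, d = N + N' + y + c + 1 := ⟨_, rfl⟩
    refine ((hk.pi_of_sigma.bex y t (hk.pi_of_sigma.bex c (.var d) (.of_mem hθ))).ex_pi
      d).of_equiv fun T hT v => ?_
    have key : ∀ g m l, Sat0 T (upd (upd (upd v d g) y m) c l) θ ↔
        Sat0 T (upd (upd v y m) c l) θ := fun g m l => by
      refine hN T _ _ fun i hi => ?_
      have : i ≠ d := by omega
      simp [upd, this]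
    have ht : ∀ g, tval T (upd v d g) t = tval T v t := fun g => by
      refine hN' T _ _ fun i hi => ?_
      have : i ≠ d := by omega
      simp [upd, this]
    have hdy : d ≠ y := by omega
    simp only [sat0_ex, e T hT, e' T hT, sat0_bex, key, ht]
    simp only [tval, upd, if_neg hdy, if_true]
    constructor
    · rintro ⟨m, hm, l, h⟩
      obtain ⟨g, hg, -⟩ := (hC T hT).exists_gt_two l l
      exact ⟨g, m, hm, l, hg, h⟩
    · rintro ⟨g, m, hm, l, -, h⟩
      exact ⟨m, hm, l, h⟩
  and {δ φ} hδ h := by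
    obtain ⟨φ', hφ', e⟩ := h
    obtain ⟨N, hN⟩ := sat0_finite_support δ
    obtain ⟨c, θ, hc, hθ, e'⟩ := hφ'.exists_normal_form hC hk N
    refine ((hk.pi_of_sigma.and hδ (.of_mem hθ)).ex_pi c).of_equiv fun T hT v => ?_
    have key : ∀ m, Sat0 T (upd v c m) δ ↔ Sat0 T v δ := fun m => by
      refine hN T _ _ fun i hi => ?_
      have : i ≠ c := by omega
      simp [upd, this]
    simp only [sat0_and, sat0_ex, e T hT, e' T hT, key, exists_and_left]
  or {δ φ} hδ h := by
    obtain ⟨φ', hφ', e⟩ := h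
    obtain ⟨N, hN⟩ := sat0_finite_support δ
    obtain ⟨c, θ, hc, hθ, e'⟩ := hφ'.exists_normal_form hC hk N
    refine ((hk.pi_of_sigma.or hδ (.of_mem hθ)).ex_pi c).of_equiv fun T hT v => ?_
    have key : ∀ m, Sat0 T (upd v c m) δ ↔ Sat0 T v δ := fun m => by
      refine hN T _ _ fun i hi => ?_
      have : i ≠ c := by omega
      simp [upd, this]
    have : Nonempty T.M := ⟨T.zero⟩
    simp only [sat0_or, sat0_ex, e T hT, e' T hT, key, exists_or, exists_const]

end Closure

section EndExtension

variable {S K : Str} {e : Emb S K} {n k : ℕ} {C : Str → Prop}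

theorem Emb.comp_upd (e : Emb S K) (v : ℕ → S.M) (x : ℕ) (m : S.M) :
    (fun i => e.j (upd v x m i)) = upd (fun i => e.j (v i)) x (e.j m) := by
  funext i
  simp only [upd]
  split_ifs <;> rfl

theorem IsEndExt.exists_of_lt (hend : IsEndExt e) (hK : PAminus K) {b : K.M} {a : S.M}
    (h : K.lt b (e.j a)) : ∃ b', S.lt b' a ∧ e.j b' = b := by
  by_cases hb : b ∈ Set.range e.j
  · obtain ⟨b', rfl⟩ := hb
    exact ⟨b', (e.lt_iff _ _).2 h, rfl⟩
  · exact absurd (hK.lt_trans _ _ _ h (hend b hb a)) (hK.lt_irrefl _)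

theorem SigmaElem.sat_iff_of_like (helem : SigmaElem e n) (hS : C S) (hK : C K) (hkn : k ≤ n)
    {φ : Fml} (h : Like C (IsSigma k) φ) (v : ℕ → S.M) :
    Sat0 S v φ ↔ Sat0 K (fun i => e.j (v i)) φ := by
  obtain ⟨ψ, hψ, eq⟩ := h
  rw [eq S hS, eq K hK]
  exact helem ψ (hψ.mono hkn) v

/-- A proper `Σₖ₊₁`-elementary end extension yields `Σₖ₊₁` collection in the ground model,
provided `Σₖ` is closed under bounded quantification in both models. -/
theorem SigmaElem.collFor (helem : SigmaElem e n) (hkn : k + 1 ≤ n) (hproper : IsProper e)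
    (hend : IsEndExt e) (hS : C S) (hK : C K) (hC : ∀ T, C T → PAminus T)
    (hk : BddClosed C (IsSigma k)) : CollFor S (IsSigma (k + 1)) := by
  intro φ hφ v x y hxy a h
  obtain ⟨D, hD⟩ := not_forall.1 hproper
  obtain ⟨c, θ, hc, hθ, eq⟩ := hφ.exists_normal_form hC hk (x + y + 1)
  obtain ⟨N, hN⟩ := sat0_finite_support θ
  obtain ⟨z, hz⟩ : ∃ z, z = N + x + y + c + 1 := ⟨_, rfl⟩
  obtain ⟨d, hd⟩ : ∃ d, d = z + 1 := ⟨_, rfl⟩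
  have key : ∀ (T : Str) (v : ℕ → T.M) a g m k l,
      Sat0 T (upd (upd (upd (upd (upd v z a) d g) x m) y k) c l) θ ↔
        Sat0 T (upd (upd (upd v x m) y k) c l) θ := fun T v a g m k l => by
    refine hN T _ _ fun i hi => ?_
    have h1 : i ≠ d := by omega
    have h2 : i ≠ z := by omega
    simp [upd, h1, h2]
  have hlike : Like C (IsSigma (k + 1))
      (.ex d (.ball x (.var z) (.bex y (.var d) (.bex c (.var d) θ)))) :=
    (hk.pi_of_sigma.ball x _ (hk.pi_of_sigma.bex y _
      (hk.pi_of_sigma.bex c _ (.of_mem hθ)))).ex_pi d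
  have hzd : z ≠ d := by omega
  have hdx : d ≠ x := by omega
  have hdy : d ≠ y := by omega
  have hiff := helem.sat_iff_of_like hS hK hkn hlike (upd v z a)
  rw [e.comp_upd] at hiff
  simp only [sat0_ex, sat0_bex, sat0_ball, key] at hiff
  simp only [tval, upd, if_neg hzd, if_neg hdx, if_neg hdy, if_true] at hiff
  obtain ⟨g, hg⟩ := hiff.2 (by
    refine ⟨D, fun m hm => ?_⟩
    obtain ⟨m, hma, rfl⟩ := hend.exists_of_lt (hC K hK) hm
    obtain ⟨p, hp⟩ := h m hma
    obtain ⟨l, hl⟩ := (eq S hS _).1 hp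
    refine ⟨e.j p, hend D hD p, e.j l, hend D hD l, ?_⟩
    have := (helem θ ((IsSigma.ofPi hθ).mono hkn) _).1 hl
    rwa [e.comp_upd, e.comp_upd, e.comp_upd] at this)
  refine ⟨g, fun m hm => ?_⟩
  obtain ⟨p, hp, l, -, hl⟩ := hg m hm
  exact ⟨p, hp, (eq S hS _).2 ⟨l, hl⟩⟩

end EndExtension

/-- Proposition `prop:endextrpi`.
Fix `n ∈ ℕ`. Let `M ⊨ IΔ₀`. If `M` admits a proper `Σₙ₊₂`-elementary end
extension `K ⊨ BΣₙ₊₁`, then `M` satisfies the weak regularity principle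
`WRφ` for every `Πₙ₊₁` formula `φ(x, y)` with parameters from `M`. -/
theorem statement_0 (n : ℕ) (S K : Str) (hS : IDelta0 S)
    (e : Emb S K) (hproper : IsProper e) (hend : IsEndExt e)
    (helem : SigmaElem e (n + 2)) (hK : BSigma K (n + 1)) :
    WRFor S (IsPi (n + 1)) := by
  let C : Str → Prop := fun T => T = S ∨ T = K
  have hCS : C S := Or.inl rfl
  have hCK : C K := Or.inr rfl
  have hC : ∀ T, C T → PAminus T := by
    rintro T (rfl | rfl)
    exacts [hS.1, hK.1.1]
  have hclosed : ∀ k ≤ n + 1, BddClosed C (IsSigma k) := by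
    intro k
    induction k with
    | zero => exact fun _ => bddClosed_sigma_zero
    | succ k ih =>
      intro hk
      have ih := ih (by omega)
      refine ih.sigma_succ hC ?_
      rintro T (rfl | rfl)
      · exact helem.collFor (by omega) hproper hend hCS hCK hC ih
      · exact fun φ hφ => hK.2 φ (hφ.mono hk)
  have hclosed := hclosed (n + 1) le_rfl
  intro φ hφ v x y hxy a h
  obtain ⟨D, hD⟩ := not_forall.1 hproper
  obtain ⟨N, hN⟩ := sat0_finite_support φ
  obtain ⟨z, hz⟩ : ∃ z, z = N + x + y + 1 := ⟨_, rfl⟩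
  have hzx : z ≠ x := by omega
  have hzy : z ≠ y := by omega
  by_cases hDφ : ∃ k, K.lt k (e.j a) ∧ Sat0 K (upd (upd (fun i => e.j (v i)) x D) y k) φ
  · obtain ⟨k, hk, hφk⟩ := hDφ
    obtain ⟨k, hka, rfl⟩ := hend.exists_of_lt hK.1.1 hk
    refine ⟨k, hka, fun b => ?_⟩
    have hlike : Like C (IsSigma (n + 2)) (.ex x (.and (.lt (.var z) (.var x)) φ)) :=
      (hclosed.pi_of_sigma.and (.lt _ _) (.of_mem hφ)).ex_pi x
    have hiff := helem.sat_iff_of_like hCS hCK le_rfl hlike (upd (upd v z b) y k)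
    have key : ∀ (T : Str) (v : ℕ → T.M) b k m, Sat0 T (upd (upd (upd v z b) y k) x m) φ ↔
        Sat0 T (upd (upd v x m) y k) φ := fun T v b k m => by
      refine hN T _ _ fun i hi => ?_
      have : i ≠ z := by omega
      by_cases hix : i = x
      · simp [upd, hix, hxy]
      · simp [upd, this, hix]
    rw [e.comp_upd, e.comp_upd] at hiff
    simp only [sat0_ex, sat0_and, sat0_lt, key] at hiff
    simp only [tval, upd, if_neg hzx, if_neg hzy, if_true] at hiff
    exact hiff.2 ⟨D, hend D hD b, hφk⟩
  · have hlike : Like C (IsSigma (n + 1)) (.ex x (.ball y (.var z) (.not φ))) :=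
      (hclosed.ball y _ (Like.of_mem hφ).neg_pi).ex_sigma x
    have hiff := helem.sat_iff_of_like hCS hCK (Nat.le_succ _) hlike (upd v z a)
    have key : ∀ (T : Str) (v : ℕ → T.M) b k m, Sat0 T (upd (upd (upd v z b) x m) y k) φ ↔
        Sat0 T (upd (upd v x m) y k) φ := fun T v b k m => by
      refine hN T _ _ fun i hi => ?_
      have : i ≠ z := by omega
      simp [upd, this]
    rw [e.comp_upd] at hiff
    simp only [sat0_ex, sat0_ball, sat0_not, key] at hiff
    simp only [tval, upd, if_neg hzx, if_true] at hiff
    obtain ⟨m, hm⟩ := hiff.2 ⟨D, fun k hk hφk => hDφ ⟨k, hk, hφk⟩⟩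
    obtain ⟨k, hk, hφk⟩ := h m
    exact absurd hφk (hm k hk)

end PaperArith
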